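/- Let q be a real number. Then for every integer n ≥ 1, with k_n = ⌊log₂ n⌋ and p_n = 2^{k_n}: S_q(n + 2p_n) = S_q(n) + S_q(2p_n) + n·q^{k_n + 2}. -/

import Mathlib

noncomputable section

open MeasureTheory Filter Finset

/-- Distance from `x` to the nearest integer. -/
def distInt (x : ℝ) : ℝ := |x - round x|

/-- The Takagi–Landsberg function with parameter `a`:
`𝒯_a(x) = ∑_{n≥0} a^n · dist(2^n x, ℤ)`. -/
def takagi (a : ℝ) (x : ℝ) : ℝ := ∑' n : ℕ, a ^ n * distInt (2 ^ n * x)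

/-- Weighted sum-of-binary-digits function: for `j = ∑ ω_i 2^i`,
`s_q(j) = ∑ ω_i q^{i+1}`. -/
def sqN (q : ℝ) (j : ℕ) : ℝ := ∑ i ∈ Finset.range j, if j.testBit i then q ^ (i + 1) else 0

/-- `S_q(n) = ∑_{j<n} s_q(j)`. -/
def Sq (q : ℝ) (n : ℕ) : ℝ := ∑ j ∈ Finset.range n, sqN q j

theorem sqN_eq_sum_range (q : ℝ) {j m : ℕ} (h : j ≤ m) :
    sqN q j = ∑ i ∈ Finset.range m, if j.testBit i then q ^ (i + 1) else 0 := by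
  refine Finset.sum_subset (Finset.range_mono h) fun i _ hi => ?_
  have hji : j < 2 ^ i :=
    (not_lt.mp (mt Finset.mem_range.mpr hi)).trans_lt Nat.lt_two_pow_self
  simp [Nat.testBit_lt_two_pow hji]

theorem sqN_two_pow_add (q : ℝ) {j m : ℕ} (h : j < 2 ^ m) :
    sqN q (2 ^ m + j) = sqN q j + q ^ (m + 1) := by
  have hm : m < 2 ^ m + j := Nat.lt_two_pow_self.trans_le (Nat.le_add_right _ _)
  have hsum : q ^ (m + 1) =
      ∑ i ∈ Finset.range (2 ^ m + j), if i = m then q ^ (i + 1) else 0 := by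
    rw [Finset.sum_ite_eq_of_mem' _ _ _ (Finset.mem_range.mpr hm)]
  rw [sqN_eq_sum_range q (Nat.le_add_left j (2 ^ m)), sqN, hsum, ← Finset.sum_add_distrib]
  refine Finset.sum_congr rfl fun i _ => ?_
  have hor : 2 ^ m + j = 2 ^ m ||| j := by simpa using Nat.two_pow_add_eq_or_of_lt h 1
  rw [hor, Nat.testBit_or, Nat.testBit_two_pow]
  by_cases him : i = m
  · subst him
    simp [Nat.testBit_lt_two_pow h]
  · simp [him, Ne.symm him]

theorem Sq_add_two_pow (q : ℝ) (n : ℕ) (hn : 1 ≤ n) (k : ℕ) (hk : k = Nat.log 2 n)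
    (p : ℕ) (hp : p = 2 ^ k) :
    Sq q (n + 2 * p) = Sq q n + Sq q (2 * p) + (n : ℝ) * q ^ (k + 2) := by
  have hp' : 2 * p = 2 ^ (k + 1) := by rw [hp, pow_succ']
  have hlt : n < 2 ^ (k + 1) := hk ▸ Nat.lt_pow_succ_log_self one_lt_two n
  rw [hp', Nat.add_comm n, Sq, Finset.sum_range_add]
  have hshift : ∑ j ∈ Finset.range n, sqN q (2 ^ (k + 1) + j) = Sq q n + n * q ^ (k + 2) := by
    rw [Finset.sum_congr rfl fun j hj =>
      sqN_two_pow_add q ((Finset.mem_range.mp hj).trans hlt), Finset.sum_add_distrib]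
    simp [Sq]
  rw [hshift, Sq, Sq]
  ring

end
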